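/- arXiv:cs/0503012 — 3 statements merged into one kernel-verified Lean document; each statement's English description precedes it below -/
import Mathlib

section
/- Let n ≥ 1 and let f : ℝⁿ × ℝ → ℝⁿ × ℝ be a bijection. Then f preserves the order of events if and only if there exists a strictly increasing bijection g : ℝ → ℝ such that the temporal component of f(x, t) equals g(t) for every x ∈ ℝⁿ and t ∈ ℝ (i.e., the time component of f is a strictly monotone increasing bijection of t alone). -/
/-- A bijection of `ℝⁿ × ℝ` preserves the order of events iff its temporal
component is a strictly monotone increasing bijection of `t` alone. -/
theorem bijection_preserves_order_of_events_iff (n : ℕ) (hn : 1 ≤ n)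
    (f : (EuclideanSpace ℝ (Fin n) × ℝ) → (EuclideanSpace ℝ (Fin n) × ℝ))
    (hf : Function.Bijective f) :
    (∀ A B : Set (EuclideanSpace ℝ (Fin n) × ℝ),
        (Prod.snd '' A = Prod.snd '' B → Prod.snd '' (f '' A) = Prod.snd '' (f '' B)) ∧
        ((∀ ta ∈ Prod.snd '' A, ∀ tb ∈ Prod.snd '' B, ta < tb) →
          ∀ ta ∈ Prod.snd '' (f '' A), ∀ tb ∈ Prod.snd '' (f '' B), ta < tb))
      ↔ ∃ g : ℝ → ℝ, Function.Bijective g ∧ StrictMono g ∧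
          ∀ (x : EuclideanSpace ℝ (Fin n)) (t : ℝ), (f (x, t)).2 = g t := by
  constructor
  · intro h
    have hconst : ∀ x t, (f (x, t)).2 = (f (0, t)).2 := fun x t => by
      simpa using (h {(x, t)} {(0, t)}).1 (by simp)
    have hmono : StrictMono fun t : ℝ => (f (0, t)).2 := fun s t hst => by
      simpa using (h {(0, s)} {(0, t)}).2 (by simpa using hst)
    refine ⟨fun t => (f (0, t)).2, ⟨hmono.injective, fun s => ?_⟩, hmono, hconst⟩
    obtain ⟨⟨x, t⟩, hxt⟩ := hf.surjective (0, s)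
    exact ⟨t, by simp [← hconst x t, hxt]⟩
  · rintro ⟨g, -, hmono, hg⟩ A B
    have himage : ∀ C : Set (EuclideanSpace ℝ (Fin n) × ℝ),
        Prod.snd '' (f '' C) = g '' (Prod.snd '' C) := fun C => by
      simp only [Set.image_image]
      exact Set.image_congr fun p _ => hg p.1 p.2
    rw [himage, himage]
    refine ⟨fun h => by rw [h], ?_⟩
    rintro h _ ⟨s, hs, rfl⟩ _ ⟨t, ht, rfl⟩
    exact hmono (h s hs t ht)
end

section
/- Let n ≥ 1 and let p₀, p₁, …, p_{n+1} be points of ℝⁿ × ℝ. There exists a map f(x, t) = (A x + t·b + c, a t + d), with A an invertible n × n real matrix, b, c ∈ ℝⁿ, a, d ∈ ℝ, a > 0, such that f(q_j) = p_j for all 0 ≤ j ≤ n+1, where (q₀, …, q_{n+1}) is the standard coordinate system of ℝⁿ × ℝ, if and only if the following three conditions hold: (i) the n+2 points p₀, …, p_{n+1} are affinely independent in ℝⁿ × ℝ ≅ ℝ^{n+1}; (ii) the points p₀, p₁, …, pₙ all have the same temporal coordinate; and (iii) the temporal coordinate of p₀ is strictly smaller than the temporal coordinate of p_{n+1}. 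-/
/-- The standard coordinate system `(q₀, q₁, …, qₙ, q_{n+1})` of `ℝⁿ × ℝ`:
`q₀ = (0,0)`, `qᵢ = (eᵢ, 0)` for `1 ≤ i ≤ n`, and `q_{n+1} = (0,1)`. -/
noncomputable def stdCoordSys (n : ℕ) : Fin (n + 2) → EuclideanSpace ℝ (Fin n) × ℝ :=
  fun j =>
    if _ : (j : ℕ) = 0 then (0, 0)
    else if h' : (j : ℕ) ≤ n then
      (EuclideanSpace.single (⟨(j : ℕ) - 1, by omega⟩ : Fin n) 1, 0)
    else (0, 1)

@[simp]
theorem stdCoordSys_zero (n : ℕ) : stdCoordSys n 0 = (0, 0) := by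
  simp [stdCoordSys]

@[simp]
theorem stdCoordSys_succ_castSucc (n : ℕ) (i : Fin n) :
    stdCoordSys n i.castSucc.succ = (EuclideanSpace.single i 1, 0) := by
  have hi : (i : ℕ) + 1 ≤ n := i.isLt
  simp [stdCoordSys, hi]

theorem stdCoordSys_succ_last (n : ℕ) : stdCoordSys n (Fin.last n).succ = (0, 1) := by
  simp [stdCoordSys]

theorem affineIndependent_iff_linearIndependent_sub_zero {V : Type*} [AddCommGroup V]
    [Module ℝ V] {n : ℕ} (p : Fin (n + 1) → V) :
    AffineIndependent ℝ p ↔ LinearIndependent ℝ fun i : Fin n => p i.succ - p 0 := by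
  rw [affineIndependent_iff_linearIndependent_vsub ℝ p 0,
    ← linearIndependent_equiv (finSuccAboveEquiv (0 : Fin (n + 1)))]
  rfl

/-- If all points except the last one are co-temporal with `p 0`, and the last one is not, then
affine independence can be tested on the spatial coordinates of the co-temporal points. -/
theorem affineIndependent_iff_linearIndependent_fst {V : Type*} [AddCommGroup V] [Module ℝ V]
    {n : ℕ} {p : Fin (n + 2) → V × ℝ} (h : ∀ i : Fin n, (p i.castSucc.succ).2 = (p 0).2)
    (hlast : (p (Fin.last n).succ).2 ≠ (p 0).2) :
    AffineIndependent ℝ p ↔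
      LinearIndependent ℝ fun i : Fin n => (p i.castSucc.succ).1 - (p 0).1 := by
  set u : Fin n → V := fun i => (p i.castSucc.succ).1 - (p 0).1 with hu
  have hsnoc : (fun i : Fin (n + 1) => p i.succ - p 0) =
      Fin.snoc (LinearMap.inl ℝ V ℝ ∘ u) (p (Fin.last n).succ - p 0) := by
    funext j
    refine Fin.lastCases ?_ (fun i => ?_) j
    · simp
    · rw [Fin.snoc_castSucc]
      ext <;> simp [hu, h i]
  have hspan : p (Fin.last n).succ - p 0 ∉
      Submodule.span ℝ (Set.range (LinearMap.inl ℝ V ℝ ∘ u)) := fun hmem => by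
    have hle : Submodule.span ℝ (Set.range (LinearMap.inl ℝ V ℝ ∘ u)) ≤
        LinearMap.ker (LinearMap.snd ℝ V ℝ) := by
      rw [Submodule.span_le]
      rintro _ ⟨i, rfl⟩
      simp
    exact hlast (sub_eq_zero.mp (by simpa using hle hmem))
  rw [affineIndependent_iff_linearIndependent_sub_zero, hsnoc, linearIndependent_finSnoc,
    and_iff_left hspan, LinearMap.linearIndependent_iff _ (LinearMap.ker_eq_bot.mpr
      LinearMap.inl_injective)]

theorem linearIndependent_toLp_col_iff_isUnit {n : ℕ} (A : Matrix (Fin n) (Fin n) ℝ) :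
    LinearIndependent ℝ (fun i => (WithLp.toLp 2 (A.col i) : EuclideanSpace ℝ (Fin n))) ↔
      IsUnit A := by
  rw [← Matrix.linearIndependent_cols_iff_isUnit]
  exact LinearMap.linearIndependent_iff (WithLp.linearEquiv 2 ℝ (Fin n → ℝ)).symm.toLinearMap
    (LinearEquiv.ker _)

theorem toEuclideanLin_single_one {n : ℕ} (A : Matrix (Fin n) (Fin n) ℝ) (i : Fin n) :
    Matrix.toEuclideanLin A (EuclideanSpace.single i 1) = WithLp.toLp 2 (A.col i) := by
  ext k
  simp [Matrix.toLpLin_apply]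

/-- `(p₀, …, p_{n+1})` is the image of the standard coordinate system of
`ℝⁿ × ℝ` under an element of `(𝒜ᶜ_st, 𝒜_t)` iff the points are affinely independent,
`p₀, …, pₙ` are co-temporal, and the temporal coordinate of `p₀` is strictly smaller
than that of `p_{n+1}`. -/
theorem image_stdCoordSys_timeIndependentAffinity_iff (n : ℕ) (hn : 1 ≤ n)
    (p : Fin (n + 2) → EuclideanSpace ℝ (Fin n) × ℝ) :
    (∃ (A : Matrix (Fin n) (Fin n) ℝ) (b c : EuclideanSpace ℝ (Fin n)) (a d : ℝ),
        IsUnit A ∧ 0 < a ∧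
        ∀ j : Fin (n + 2),
          (Matrix.toEuclideanLin A (stdCoordSys n j).1 + (stdCoordSys n j).2 • b + c,
            a * (stdCoordSys n j).2 + d) = p j)
      ↔ (AffineIndependent ℝ p ∧
         (∀ j : Fin (n + 2), (j : ℕ) ≤ n → (p j).2 = (p 0).2) ∧
         (p 0).2 < (p (Fin.last (n + 1))).2) := by
  rw [← Fin.succ_last]
  constructor
  · rintro ⟨A, b, c, a, d, hA, ha, hp⟩
    have h0 := hp 0
    have hcast (i : Fin n) := hp i.castSucc.succ
    have hlast := hp (Fin.last n).succ
    simp only [stdCoordSys_zero, stdCoordSys_succ_castSucc, stdCoordSys_succ_last,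
      toEuclideanLin_single_one, map_zero, zero_smul, one_smul, mul_zero, mul_one, zero_add,
      add_zero] at h0 hcast hlast
    have hlt : (p 0).2 < (p (Fin.last n).succ).2 := by
      rw [← h0, ← hlast]
      exact lt_add_of_pos_left d ha
    have htime (i : Fin n) : (p i.castSucc.succ).2 = (p 0).2 := by
      simp [← h0, ← hcast]
    refine ⟨?_, fun j hj => ?_, hlt⟩
    · rw [affineIndependent_iff_linearIndependent_fst htime hlt.ne']
      simpa [← h0, ← hcast] using (linearIndependent_toLp_col_iff_isUnit A).mpr hA
    · induction j using Fin.cases with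
      | zero => rfl
      | succ j =>
        induction j using Fin.lastCases with
        | last => simp at hj
        | cast i => exact htime i
  · rintro ⟨hind, htime, hlt⟩
    have htime' (i : Fin n) : (p i.castSucc.succ).2 = (p 0).2 := htime _ (by simp)
    rw [affineIndependent_iff_linearIndependent_fst htime' hlt.ne'] at hind
    refine ⟨Matrix.of fun k i => ((p i.castSucc.succ).1 - (p 0).1) k,
      (p (Fin.last n).succ).1 - (p 0).1, (p 0).1, (p (Fin.last n).succ).2 - (p 0).2, (p 0).2,
      (linearIndependent_toLp_col_iff_isUnit _).mp hind, sub_pos.mpr hlt, fun j => ?_⟩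
    induction j using Fin.cases with
    | zero => simp
    | succ j =>
      induction j using Fin.lastCases with
      | last =>
        rw [stdCoordSys_succ_last]
        simp [-Fin.succ_last]
      | cast i =>
        rw [stdCoordSys_succ_castSucc, toEuclideanLin_single_one]
        ext k
        · simp [Matrix.col]
        · simp [htime' i]
end

section
/- Let n ≥ 1. For each τ ∈ ℝ let G_τ : ℝⁿ → ℝⁿ be an affine bijection, let a > 0 and β ∈ ℝ, and define f : ℝⁿ × ℝ → ℝⁿ × ℝ by f(x, t) = (G_t(x), a t + β). Let p₁, p₂, p₃ ∈ ℝⁿ × ℝ be co-temporal points with common temporal coordinate τ whose spatial parts are collinear, and let q₁, q₂, q₃ ∈ ℝⁿ × ℝ be arbitrary. If (t_{q₃} − t_{q₁})² · ‖x_{p₂} − x_{p₁}‖² = (t_{q₂} − t_{q₁})² · ‖x_{p₃} − x_{p₁}‖², then the images f(p₁), f(p₂), f(p₃) are co-temporal with collinear spatial parts and ((a·t_{q₃} + β) − (a·t_{q₁} + β))² · ‖G_τ(x_{p₂}) − G_τ(x_{p₁})‖² = ((a·t_{q₂} + β) − (a·t_{q₁} + β))² · ‖G_τ(x_{p₃})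 − G_τ(x_{p₁})‖²; that is, the predicate EqCR^{s,t} is invariant under elements of the group (𝒜_st, 𝒜_t). -/
/-- The image of a collinear set under an affine map is collinear. -/
theorem Collinear.image_affineMap {k V W P Q : Type*} [DivisionRing k] [AddCommGroup V] [Module k V]
    [AddTorsor V P] [AddCommGroup W] [Module k W] [AddTorsor W Q] {s : Set P}
    (h : Collinear k s) (g : P →ᵃ[k] Q) : Collinear k (g '' s) := by
  obtain ⟨p, v, hv⟩ := (collinear_iff_exists_forall_eq_smul_vadd _).1 h
  refine (collinear_iff_exists_forall_eq_smul_vadd _).2 ⟨g p, g.linear v, ?_⟩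
  rintro _ ⟨q, hq, rfl⟩
  obtain ⟨r, rfl⟩ := hv q hq
  exact ⟨r, by rw [AffineMap.map_vadd, map_smul]⟩

/-- An affine map preserves proportions between squared distances from a common base point
along a line. -/
theorem Collinear.mul_norm_sub_sq_map {E F : Type*} [NormedAddCommGroup E] [NormedSpace ℝ E]
    [NormedAddCommGroup F] [NormedSpace ℝ F] {x y z : E} (h : Collinear ℝ {x, y, z})
    (g : E →ᵃ[ℝ] F) {c d : ℝ} (heq : c * ‖y - x‖ ^ 2 = d * ‖z - x‖ ^ 2) :
    c * ‖g y - g x‖ ^ 2 = d * ‖g z - g x‖ ^ 2 := by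
  obtain ⟨v, hv⟩ := (collinear_iff_of_mem (p₀ := x) (by simp)).1 h
  obtain ⟨r, rfl⟩ := hv y (by simp)
  obtain ⟨s, rfl⟩ := hv z (by simp)
  by_cases hv0 : v = 0
  · simp [hv0]
  · have hn : ‖v‖ ^ 2 ≠ 0 := by positivity
    simp only [← vsub_eq_sub, vadd_vsub, norm_smul, mul_pow, ← mul_assoc] at heq
    have hrs := mul_right_cancel₀ hn heq
    simp only [← vsub_eq_sub, AffineMap.map_vadd, map_smul, vadd_vsub, norm_smul, mul_pow,
      ← mul_assoc, hrs]

/-- The predicate `EqCR^{s,t}` is invariant under elements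
`f(x, t) = (G_t(x), a·t + β)` of the group `(𝒜_st, 𝒜_t)` of time-dependent
spatio-temporal affinities. -/
theorem eqCR_invariant_under_timeDependentAffinity (n : ℕ) (hn : 1 ≤ n)
    (G : ℝ → (EuclideanSpace ℝ (Fin n) ≃ᵃ[ℝ] EuclideanSpace ℝ (Fin n)))
    (a β : ℝ) (ha : 0 < a) (τ : ℝ)
    (p₁ p₂ p₃ q₁ q₂ q₃ : EuclideanSpace ℝ (Fin n) × ℝ)
    (hp₁ : p₁.2 = τ) (hp₂ : p₂.2 = τ) (hp₃ : p₃.2 = τ)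
    (hcol : Collinear ℝ {p₁.1, p₂.1, p₃.1})
    (heq : (q₃.2 - q₁.2) ^ 2 * ‖p₂.1 - p₁.1‖ ^ 2
            = (q₂.2 - q₁.2) ^ 2 * ‖p₃.1 - p₁.1‖ ^ 2) :
    (a * p₁.2 + β = a * p₂.2 + β ∧ a * p₂.2 + β = a * p₃.2 + β) ∧
    Collinear ℝ {G p₁.2 p₁.1, G p₂.2 p₂.1, G p₃.2 p₃.1} ∧
    ((a * q₃.2 + β) - (a * q₁.2 + β)) ^ 2 * ‖G τ p₂.1 - G τ p₁.1‖ ^ 2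
      = ((a * q₂.2 + β) - (a * q₁.2 + β)) ^ 2 * ‖G τ p₃.1 - G τ p₁.1‖ ^ 2 := by
  subst hp₁
  refine ⟨by simp [hp₂, hp₃], ?_, ?_⟩
  · rw [hp₂, hp₃]
    simpa [Set.image_insert_eq] using hcol.image_affineMap (G p₁.2).toAffineMap
  · have h := hcol.mul_norm_sub_sq_map (G p₁.2).toAffineMap heq
    simp only [AffineEquiv.coe_toAffineMap] at h
    linear_combination a ^ 2 * h
end
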